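/- For every β > 0 and N ≥ 1 there exists a constant c ∈ (0,1] (depending only on β and N) with the following property: let A : ℝ^{2N} → ℝ^{2N} be a symplectic linear automorphism and let E, F ⊂ ℝ^{2N} be subspaces with dim E = dim F ≥ 1 such that ∠(E^ω, F) > β and ∠((A E)^ω, A F) > β; then c ≤ m(A|_E) · ‖A|_F‖ ≤ c^{−1}, where m(A|_E) is the co-norm of the restriction of A to E and ‖A|_F‖ is the operator norm of the restriction of A to F. -/

import Mathlib

noncomputable section

/-- The standard symplectic form `ω = Σᵢ dpᵢ ∧ dqᵢ` on `ℝ^{2N}`, where the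
coordinates `p₁,…,p_N` occupy the first `N` indices and `q₁,…,q_N` the last `N`. -/
def stdSymp (N : ℕ) (v w : EuclideanSpace ℝ (Fin (N + N))) : ℝ :=
  ∑ i : Fin N,
    (v (Fin.castAdd N i) * w (Fin.natAdd N i) - v (Fin.natAdd N i) * w (Fin.castAdd N i))

lemma stdSymp_add_right (N : ℕ) (v a b : EuclideanSpace ℝ (Fin (N + N))) :
    stdSymp N v (a + b) = stdSymp N v a + stdSymp N v b := by
  simp only [stdSymp, PiLp.add_apply, ← Finset.sum_add_distrib]
  exact Finset.sum_congr rfl fun i _ => by ring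

lemma stdSymp_smul_right (N : ℕ) (c : ℝ) (v a : EuclideanSpace ℝ (Fin (N + N))) :
    stdSymp N v (c • a) = c * stdSymp N v a := by
  simp only [stdSymp, PiLp.smul_apply, smul_eq_mul, Finset.mul_sum]
  exact Finset.sum_congr rfl fun i _ => by ring

/-- The symplectic complement `E^ω = {w : ω(v,w) = 0 for all v ∈ E}` with respect
to the standard symplectic form on `ℝ^{2N}`. -/
def sympCompl (N : ℕ) (E : Submodule ℝ (EuclideanSpace ℝ (Fin (N + N)))) :
    Submodule ℝ (EuclideanSpace ℝ (Fin (N + N))) where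
  carrier := {w | ∀ v ∈ E, stdSymp N v w = 0}
  add_mem' := by
    intro a b ha hb v hv
    rw [stdSymp_add_right, ha v hv, hb v hv, add_zero]
  zero_mem' := by
    intro v hv
    have : stdSymp N v ((0:ℝ) • (0 : EuclideanSpace ℝ (Fin (N + N)))) = 0 := by
      rw [stdSymp_smul_right]; ring
    simpa using this
  smul_mem' := by
    intro c a ha v hv
    rw [stdSymp_smul_right, ha v hv, mul_zero]

/-- The angle `∠(E,F) ∈ [0,π/2]` between subspaces: the infimum of the angles
`∠(v,w)` over nonzero `v ∈ E`, `w ∈ F`.  (The set over which the infimum is taken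
is augmented by `π/2`; since for nonzero subspaces the infimum of the angles is
always `≤ π/2`, this does not change its value, while it makes the angle equal to
the junk value `π/2` when one of the subspaces is trivial.) -/
def subAngle {V : Type*} [NormedAddCommGroup V] [InnerProductSpace ℝ V]
    (E F : Submodule ℝ V) : ℝ :=
  sInf ({Real.pi / 2} ∪
    {θ : ℝ | ∃ v ∈ E, v ≠ 0 ∧ ∃ w ∈ F, w ≠ 0 ∧ θ = InnerProductGeometry.angle v w})

/-- The co-norm `m(A|_S) = inf {‖A v‖ : v ∈ S, ‖v‖ = 1}` of a linear map
restricted to a subspace. -/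
def conormOn (N : ℕ)
    (A : EuclideanSpace ℝ (Fin (N + N)) →ₗ[ℝ] EuclideanSpace ℝ (Fin (N + N)))
    (S : Submodule ℝ (EuclideanSpace ℝ (Fin (N + N)))) : ℝ :=
  sInf {r : ℝ | ∃ v ∈ S, ‖v‖ = 1 ∧ r = ‖A v‖}

/-- The norm `‖A|_S‖ = sup {‖A v‖ : v ∈ S, ‖v‖ = 1}` of a linear map restricted to
a subspace. -/
def normOn (N : ℕ)
    (A : EuclideanSpace ℝ (Fin (N + N)) →ₗ[ℝ] EuclideanSpace ℝ (Fin (N + N)))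
    (S : Submodule ℝ (EuclideanSpace ℝ (Fin (N + N)))) : ℝ :=
  sSup {r : ℝ | ∃ v ∈ S, ‖v‖ = 1 ∧ r = ‖A v‖}

open scoped RealInnerProductSpace

/-- The complex structure `J` representing the standard symplectic form:
`ω(v, w) = ⟪v, J w⟫`. -/
def sympJ (N : ℕ) : EuclideanSpace ℝ (Fin (N + N)) →ₗ[ℝ] EuclideanSpace ℝ (Fin (N + N)) where
  toFun w := WithLp.toLp 2
    (Fin.append (fun i : Fin N => w (Fin.natAdd N i)) (fun i : Fin N => -w (Fin.castAdd N i)))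
  map_add' a b := by
    ext k
    refine Fin.addCases (fun i => ?_) (fun i => ?_) k
    · simp only [PiLp.add_apply, Fin.append_left]
    · simp only [PiLp.add_apply, Fin.append_right, neg_add]
  map_smul' r a := by
    ext k
    refine Fin.addCases (fun i => ?_) (fun i => ?_) k
    · simp only [PiLp.smul_apply, Fin.append_left, RingHom.id_apply]
    · simp only [PiLp.smul_apply, Fin.append_right, RingHom.id_apply, smul_neg]

lemma sympJ_castAdd (N : ℕ) (w : EuclideanSpace ℝ (Fin (N + N))) (i : Fin N) :
    sympJ N w (Fin.castAdd N i) = w (Fin.natAdd N i) :=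
  Fin.append_left (fun i : Fin N => w (Fin.natAdd N i)) (fun i : Fin N => -w (Fin.castAdd N i)) i

lemma sympJ_natAdd (N : ℕ) (w : EuclideanSpace ℝ (Fin (N + N))) (i : Fin N) :
    sympJ N w (Fin.natAdd N i) = -w (Fin.castAdd N i) :=
  Fin.append_right (fun i : Fin N => w (Fin.natAdd N i)) (fun i : Fin N => -w (Fin.castAdd N i)) i

lemma sympJ_sympJ (N : ℕ) (w : EuclideanSpace ℝ (Fin (N + N))) :
    sympJ N (sympJ N w) = -w := by
  ext k
  refine Fin.addCases (fun i => ?_) (fun i => ?_) k <;>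
    simp only [sympJ_castAdd, sympJ_natAdd, PiLp.neg_apply]

lemma stdSymp_eq_inner (N : ℕ) (v w : EuclideanSpace ℝ (Fin (N + N))) :
    stdSymp N v w = ⟪v, sympJ N w⟫ := by
  simp only [stdSymp, PiLp.inner_apply, Fin.sum_univ_add, sympJ_castAdd, sympJ_natAdd,
    ← Finset.sum_add_distrib, RCLike.inner_apply, conj_trivial]
  exact Finset.sum_congr rfl fun i _ => by ring

lemma inner_sympJ_sympJ (N : ℕ) (v w : EuclideanSpace ℝ (Fin (N + N))) :
    ⟪sympJ N v, sympJ N w⟫ = ⟪v, w⟫ := by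
  simp only [PiLp.inner_apply, Fin.sum_univ_add, sympJ_castAdd, sympJ_natAdd,
    RCLike.inner_apply, conj_trivial]
  rw [add_comm]
  simp only [neg_mul_neg]

lemma norm_sympJ (N : ℕ) (w : EuclideanSpace ℝ (Fin (N + N))) : ‖sympJ N w‖ = ‖w‖ := by
  rw [norm_eq_sqrt_real_inner, inner_sympJ_sympJ, ← norm_eq_sqrt_real_inner]

lemma abs_stdSymp_le (N : ℕ) (v w : EuclideanSpace ℝ (Fin (N + N))) :
    |stdSymp N v w| ≤ ‖v‖ * ‖w‖ := by
  rw [stdSymp_eq_inner, ← norm_sympJ N w]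
  exact abs_real_inner_le_norm _ _

section SubAngle

variable {V : Type*} [NormedAddCommGroup V] [InnerProductSpace ℝ V] {E F : Submodule ℝ V}

lemma bddBelow_subAngle_set (E F : Submodule ℝ V) :
    BddBelow ({Real.pi / 2} ∪
      {θ : ℝ | ∃ v ∈ E, v ≠ 0 ∧ ∃ w ∈ F, w ≠ 0 ∧ θ = InnerProductGeometry.angle v w}) := by
  refine ⟨0, ?_⟩
  rintro θ (rfl | ⟨v, -, -, w, -, -, rfl⟩)
  · positivity
  · exact InnerProductGeometry.angle_nonneg _ _

lemma subAngle_le_pi_div_two (E F : Submodule ℝ V) : subAngle E F ≤ Real.pi / 2 :=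
  csInf_le (bddBelow_subAngle_set E F) (Or.inl rfl)

lemma subAngle_le_angle {v w : V} (hv : v ∈ E) (hv0 : v ≠ 0) (hw : w ∈ F) (hw0 : w ≠ 0) :
    subAngle E F ≤ InnerProductGeometry.angle v w :=
  csInf_le (bddBelow_subAngle_set E F) (Or.inr ⟨v, hv, hv0, w, hw, hw0, rfl⟩)

lemma inner_le_cos_mul_of_le_subAngle {β : ℝ} (hβ : 0 ≤ β) (h : β ≤ subAngle E F) {v w : V}
    (hv : v ∈ E) (hw : w ∈ F) : ⟪v, w⟫ ≤ Real.cos β * (‖v‖ * ‖w‖) := by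
  rcases eq_or_ne v 0 with rfl | hv0
  · simp
  rcases eq_or_ne w 0 with rfl | hw0
  · simp
  rw [← InnerProductGeometry.cos_angle_mul_norm_mul_norm]
  gcongr
  exact Real.cos_le_cos_of_nonneg_of_le_pi hβ (InnerProductGeometry.angle_le_pi _ _)
    (h.trans (subAngle_le_angle hv hv0 hw hw0))

end SubAngle

/-- The operator `F → E` representing the pairing of `E` and `F` by the symplectic form. -/
def sympPairing (N : ℕ) (E F : Submodule ℝ (EuclideanSpace ℝ (Fin (N + N)))) : F →ₗ[ℝ] E :=
  E.orthogonalProjectionOnto.toLinearMap ∘ₗ sympJ N ∘ₗ F.subtype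

lemma stdSymp_eq_inner_sympPairing (N : ℕ) (E F : Submodule ℝ (EuclideanSpace ℝ (Fin (N + N))))
    (v : E) (w : F) : stdSymp N v w = ⟪v, sympPairing N E F w⟫ := by
  rw [stdSymp_eq_inner]
  exact (Submodule.inner_orthogonalProjectionOnto_eq_of_mem_left v _).symm

lemma sin_mul_norm_le_norm_sympPairing {N : ℕ} {β : ℝ} (hβ : 0 ≤ β) (hβ' : β ≤ Real.pi / 2)
    {E F : Submodule ℝ (EuclideanSpace ℝ (Fin (N + N)))}
    (h : β ≤ subAngle (sympCompl N E) F) (w : F) :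
    Real.sin β * ‖w‖ ≤ ‖sympPairing N E F w‖ := by
  set x : EuclideanSpace ℝ (Fin (N + N)) := sympJ N w
  set y : EuclideanSpace ℝ (Fin (N + N)) :=
    Subtype.val (E.orthogonalProjectionOnto x)
  have hort : ∀ v ∈ E, ⟪v, x - y⟫ = 0 := fun v hv => by
    rw [inner_sub_right, sub_eq_zero]
    exact (Submodule.inner_orthogonalProjectionOnto_eq_of_mem_left (⟨v, hv⟩ : E) x).symm
  have hJ : sympJ N (-sympJ N (x - y)) = x - y := by
    rw [map_neg, sympJ_sympJ, neg_neg]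
  have hmem : -sympJ N (x - y) ∈ sympCompl N E := fun v hv => by
    rw [stdSymp_eq_inner, hJ]
    exact hort v hv
  have hle := inner_le_cos_mul_of_le_subAngle hβ h hmem w.2
  have hyx : ⟪y, x - y⟫ = 0 := hort y (Subtype.prop _)
  have hx : ‖x‖ = ‖w‖ := norm_sympJ N w
  rw [← inner_sympJ_sympJ, hJ, norm_neg, norm_sympJ, ← Submodule.coe_norm, ← hx] at hle
  have hxx : ⟪x - y, x⟫ = ‖x - y‖ ^ 2 := by
    rw [← real_inner_self_eq_norm_sq]
    conv_rhs => rw [inner_sub_right]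
    rw [real_inner_comm y (x - y), hyx, sub_zero]
  have hpyth : ‖x‖ ^ 2 = ‖y‖ ^ 2 + ‖x - y‖ ^ 2 := by
    have := norm_add_sq_real y (x - y)
    rw [hyx, add_sub_cancel] at this
    linarith
  change ⟪x - y, x⟫ ≤ _ at hle
  have hcos : 0 ≤ Real.cos β := Real.cos_nonneg_of_mem_Icc ⟨by linarith, hβ'⟩
  have hz : ‖x - y‖ ≤ Real.cos β * ‖x‖ := by
    rcases (norm_nonneg (x - y)).eq_or_lt with h0 | h0
    · rw [← h0]
      positivity
    · refine le_of_mul_le_mul_left ?_ h0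
      nlinarith
  have hgoal : Real.sin β * ‖x‖ ≤ ‖y‖ := by
    refine abs_le_of_sq_le_sq' ?_ (norm_nonneg y) |>.2
    have := pow_le_pow_left₀ (norm_nonneg _) hz 2
    nlinarith [Real.sin_sq_add_cos_sq β]
  rw [hx] at hgoal
  exact hgoal

/-- If `∠(E^ω, F) ≥ β`, every `w ∈ F` pairs almost maximally with some `v ∈ E`. -/
lemma exists_stdSymp_ge_left {N : ℕ} {β : ℝ} (hβ : 0 < β) (hβ' : β < Real.pi / 2)
    {E F : Submodule ℝ (EuclideanSpace ℝ (Fin (N + N)))}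
    (h : β ≤ subAngle (sympCompl N E) F) {w : EuclideanSpace ℝ (Fin (N + N))} (hw : w ∈ F)
    (hw0 : w ≠ 0) :
    ∃ v ∈ E, v ≠ 0 ∧ Real.sin β * ‖v‖ * ‖w‖ ≤ stdSymp N v w := by
  have hs : 0 < Real.sin β := Real.sin_pos_of_pos_of_lt_pi hβ (by linarith [Real.pi_pos])
  have hT := sin_mul_norm_le_norm_sympPairing hβ.le hβ'.le h ⟨w, hw⟩
  set v := sympPairing N E F ⟨w, hw⟩ with hv
  rw [Submodule.coe_norm] at hT
  have hpos : 0 < ‖v‖ := (mul_pos hs (norm_pos_iff.2 hw0)).trans_le hT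
  refine ⟨v, v.2, fun h0 => hpos.ne' (by rw [Submodule.coe_norm, h0, norm_zero]), ?_⟩
  have := stdSymp_eq_inner_sympPairing N E F v ⟨w, hw⟩
  rw [← hv, real_inner_self_eq_norm_sq] at this
  rw [this, ← Submodule.coe_norm]
  simp only at hT
  nlinarith

/-- If `∠(E^ω, F) ≥ β` and `dim E = dim F`, every `v ∈ E` pairs almost maximally with some
`w ∈ F`. -/
lemma exists_stdSymp_ge_right {N : ℕ} {β : ℝ} (hβ : 0 < β) (hβ' : β < Real.pi / 2)
    {E F : Submodule ℝ (EuclideanSpace ℝ (Fin (N + N)))}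
    (hEF : Module.finrank ℝ E = Module.finrank ℝ F)
    (h : β ≤ subAngle (sympCompl N E) F) {v : EuclideanSpace ℝ (Fin (N + N))} (hv : v ∈ E)
    (hv0 : v ≠ 0) :
    ∃ w ∈ F, w ≠ 0 ∧ Real.sin β * ‖v‖ * ‖w‖ ≤ stdSymp N v w := by
  have hs : 0 < Real.sin β := Real.sin_pos_of_pos_of_lt_pi hβ (by linarith [Real.pi_pos])
  have hT := sin_mul_norm_le_norm_sympPairing hβ.le hβ'.le h
  have hinj : Function.Injective (sympPairing N E F) := by
    refine (injective_iff_map_eq_zero _).2 fun w hw => ?_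
    have := hT w
    rw [hw, norm_zero] at this
    exact norm_le_zero_iff.1 (nonpos_of_mul_nonpos_right this hs)
  obtain ⟨w, hw⟩ := (LinearMap.injective_iff_surjective_of_finrank_eq_finrank hEF.symm).1 hinj
    ⟨v, hv⟩
  refine ⟨w, w.2, fun h0 => hv0 ?_, ?_⟩
  · have : w = 0 := Subtype.ext h0
    rw [this, map_zero] at hw
    exact (congrArg Subtype.val hw).symm
  · have h1 := stdSymp_eq_inner_sympPairing N E F ⟨v, hv⟩ w
    rw [hw, real_inner_self_eq_norm_sq] at h1
    have h2 := hT w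
    rw [hw] at h2
    simp only [Submodule.coe_norm] at h1 h2
    rw [h1]
    nlinarith [norm_nonneg v]

section RestrictedNorms

variable {N : ℕ} (A : EuclideanSpace ℝ (Fin (N + N)) →ₗ[ℝ] EuclideanSpace ℝ (Fin (N + N)))
  {S : Submodule ℝ (EuclideanSpace ℝ (Fin (N + N)))}

lemma conormOn_nonneg (S : Submodule ℝ (EuclideanSpace ℝ (Fin (N + N)))) :
    0 ≤ conormOn N A S :=
  Real.sInf_nonneg (by rintro _ ⟨v, -, -, rfl⟩; exact norm_nonneg _)

lemma normOn_nonneg (S : Submodule ℝ (EuclideanSpace ℝ (Fin (N + N)))) : 0 ≤ normOn N A S :=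
  Real.sSup_nonneg (by rintro _ ⟨v, -, -, rfl⟩; exact norm_nonneg _)

lemma conormOn_mul_norm_le {v : EuclideanSpace ℝ (Fin (N + N))} (hv : v ∈ S) :
    conormOn N A S * ‖v‖ ≤ ‖A v‖ := by
  rcases eq_or_ne v 0 with rfl | hv0
  · simp
  have hpos := norm_pos_iff.2 hv0
  rw [← le_div_iff₀ hpos]
  refine csInf_le ⟨0, by rintro _ ⟨v, -, -, rfl⟩; exact norm_nonneg _⟩
    ⟨‖v‖⁻¹ • v, S.smul_mem _ hv, norm_smul_inv_norm hv0, ?_⟩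
  rw [map_smul, norm_smul, norm_inv, norm_norm, div_eq_inv_mul]

lemma norm_le_normOn_mul {v : EuclideanSpace ℝ (Fin (N + N))} (hv : v ∈ S) :
    ‖A v‖ ≤ normOn N A S * ‖v‖ := by
  rcases eq_or_ne v 0 with rfl | hv0
  · simp
  have hpos := norm_pos_iff.2 hv0
  rw [← div_le_iff₀ hpos]
  refine le_csSup ⟨‖A.toContinuousLinearMap‖, ?_⟩
    ⟨‖v‖⁻¹ • v, S.smul_mem _ hv, norm_smul_inv_norm hv0, ?_⟩
  · rintro _ ⟨u, -, hu, rfl⟩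
    simpa [hu] using A.toContinuousLinearMap.le_opNorm u
  · rw [map_smul, norm_smul, norm_inv, norm_norm, div_eq_inv_mul]

lemma exists_unit_mem (hS : 1 ≤ Module.finrank ℝ S) : ∃ v ∈ S, ‖v‖ = 1 := by
  have : S ≠ ⊥ := by
    rintro rfl
    simp at hS
  obtain ⟨v, hv, hv0⟩ := S.exists_mem_ne_zero_of_ne_bot this
  exact ⟨‖v‖⁻¹ • v, S.smul_mem _ hv, norm_smul_inv_norm hv0⟩

lemma le_conormOn (hS : 1 ≤ Module.finrank ℝ S) {r : ℝ}
    (h : ∀ v ∈ S, ‖v‖ = 1 → r ≤ ‖A v‖) : r ≤ conormOn N A S := by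
  obtain ⟨v, hv, hv1⟩ := exists_unit_mem hS
  exact le_csInf ⟨_, v, hv, hv1, rfl⟩ (by rintro _ ⟨u, hu, hu1, rfl⟩; exact h u hu hu1)

lemma normOn_le (hS : 1 ≤ Module.finrank ℝ S) {r : ℝ}
    (h : ∀ v ∈ S, ‖v‖ = 1 → ‖A v‖ ≤ r) : normOn N A S ≤ r := by
  obtain ⟨v, hv, hv1⟩ := exists_unit_mem hS
  exact csSup_le ⟨_, v, hv, hv1, rfl⟩ (by rintro _ ⟨u, hu, hu1, rfl⟩; exact h u hu hu1)

end RestrictedNorms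

/-- For every `β > 0` and `N ≥ 1` there is `c ∈ (0,1]` such
that: if `A` is a symplectic linear automorphism of `ℝ^{2N}` and `E, F` are
subspaces of equal dimension `≥ 1` with `∠(E^ω, F) > β` and `∠((AE)^ω, AF) > β`,
then `c ≤ m(A|_E)·‖A|_F‖ ≤ c⁻¹`. -/
theorem stmt_16 (N : ℕ) (hN : 1 ≤ N) (β : ℝ) (hβ : 0 < β) :
    ∃ c : ℝ, 0 < c ∧ c ≤ 1 ∧
      ∀ A : EuclideanSpace ℝ (Fin (N + N)) ≃ₗ[ℝ] EuclideanSpace ℝ (Fin (N + N)),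
        (∀ v w, stdSymp N (A v) (A w) = stdSymp N v w) →
        ∀ E F : Submodule ℝ (EuclideanSpace ℝ (Fin (N + N))),
          Module.finrank ℝ E = Module.finrank ℝ F → 1 ≤ Module.finrank ℝ E →
          β < subAngle (sympCompl N E) F →
          β < subAngle (sympCompl N (E.map (A : EuclideanSpace ℝ (Fin (N + N)) →ₗ[ℝ]
            EuclideanSpace ℝ (Fin (N + N)))))
            (F.map (A : EuclideanSpace ℝ (Fin (N + N)) →ₗ[ℝ]
            EuclideanSpace ℝ (Fin (N + N)))) →
          c ≤ conormOn N A E * normOn N A F ∧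
            conormOn N A E * normOn N A F ≤ c⁻¹ := by
  rcases le_or_gt (Real.pi / 2) β with hβ' | hβ'
  · refine ⟨1, one_pos, le_rfl, fun A _ E F _ _ h _ => ?_⟩
    exact absurd (h.trans_le (subAngle_le_pi_div_two _ _)) hβ'.not_gt
  have hs : 0 < Real.sin β := Real.sin_pos_of_pos_of_lt_pi hβ (by linarith [Real.pi_pos])
  refine ⟨Real.sin β, hs, Real.sin_le_one β, fun A hA E F hEF hE h h' => ?_⟩
  set B : EuclideanSpace ℝ (Fin (N + N)) →ₗ[ℝ] EuclideanSpace ℝ (Fin (N + N)) :=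
    (A : EuclideanSpace ℝ (Fin (N + N)) →ₗ[ℝ] EuclideanSpace ℝ (Fin (N + N)))
  have hB : ∀ v w, stdSymp N (B v) (B w) = stdSymp N v w := hA
  have hm := conormOn_nonneg B E
  have hM := normOn_nonneg B F
  constructor
  · have key : ∀ v ∈ E, ‖v‖ = 1 → Real.sin β ≤ ‖B v‖ * normOn N B F := fun v hv hv1 => by
      obtain ⟨w, hw, hw0, hvw⟩ := exists_stdSymp_ge_right hβ hβ' hEF h.le hv
        (norm_ne_zero_iff.1 (by rw [hv1]; exact one_ne_zero))
      rw [hv1, mul_one, ← hB] at hvw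
      have h1 := (le_abs_self _).trans (abs_stdSymp_le N (B v) (B w))
      have h2 := mul_le_mul_of_nonneg_left (norm_le_normOn_mul B hw) (norm_nonneg (B v))
      refine le_of_mul_le_mul_right ?_ (norm_pos_iff.2 hw0)
      linarith
    have hMpos : 0 < normOn N B F := by
      obtain ⟨v, hv, hv1⟩ := exists_unit_mem hE
      refine hM.lt_of_ne fun h0 => ?_
      have := key v hv hv1
      rw [← h0, mul_zero] at this
      linarith
    rw [← div_le_iff₀ hMpos]
    exact le_conormOn B hE fun v hv hv1 => (div_le_iff₀ hMpos).2 (key v hv hv1)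
  · have key : ∀ w ∈ F, ‖w‖ = 1 → conormOn N B E * ‖B w‖ ≤ (Real.sin β)⁻¹ := fun w hw hw1 => by
      have hw0 : B w ≠ 0 := fun h0 => by
        rw [A.map_eq_zero_iff.1 h0, norm_zero] at hw1
        exact zero_ne_one hw1
      obtain ⟨_, ⟨v, hv, rfl⟩, hv0, hvw⟩ := exists_stdSymp_ge_left hβ hβ' h'.le
        (Submodule.mem_map_of_mem hw) hw0
      change Real.sin β * ‖B v‖ * ‖B w‖ ≤ stdSymp N (B v) (B w) at hvw
      rw [hB] at hvw
      have h1 := (le_abs_self _).trans (abs_stdSymp_le N v w)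
      have h2 := conormOn_mul_norm_le B hv
      have h3 := mul_le_mul_of_nonneg_left (hvw.trans h1) hm
      have hpos : 0 < ‖B v‖ := norm_pos_iff.2 hv0
      rw [hw1, mul_one] at h3
      rw [← one_div, le_div_iff₀ hs]
      refine le_of_mul_le_mul_right ?_ hpos
      linarith
    rcases hm.eq_or_lt with h0 | hmpos
    · rw [← h0, zero_mul]
      exact (inv_pos.2 hs).le
    · rw [mul_comm, ← le_div_iff₀ hmpos]
      refine normOn_le B (hEF ▸ hE) fun w hw hw1 => (le_div_iff₀ hmpos).2 ?_
      rw [mul_comm]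
      exact key w hw hw1
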